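/- Let n ≥ k ≥ 1 and for each j ∈ {1,…,n} let (A_1^j, …, A_k^j) be a family of closed subsets of Δ^{k−1}. Suppose that for every subset I ⊆ {1,…,n} with |I| = n−k+1, the family (⋃_{j∈I} A_1^j, …, ⋃_{j∈I} A_k^j) is a KKM cover of Δ^{k−1}. Then there exists an injective function π : {1,…,k} → {1,…,n} such that ⋂_{i=1}^k A_i^{π(i)} ≠ ∅. -/

import Mathlib

/-- The face of the standard simplex `Δ^{k-1}` corresponding to a nonempty set
`σ ⊆ {1,…,k}` of vertices: the points of the simplex supported on `σ`. -/
def simplexFace (k : ℕ) (σ : Finset (Fin k)) : Set (Fin k → ℝ) :=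
  {x ∈ stdSimplex ℝ (Fin k) | ∀ i ∉ σ, x i = 0}

/-- A finite set `P` is dominant for the orders induced by the functions `r i` when no point lies
strictly above the `r i`-minimum of `P` for every `i` simultaneously. -/
def IsDominant {ι V α : Type*} [LE α] (r : ι → V → α) (P : Finset V) : Prop :=
  ∀ y, ∃ i, ∀ x ∈ P, r i y ≤ r i x

section Scarf

variable {ι V α : Type*}

open Classical in
/-- In a set that does not carry all the colours, the number of facets carrying every colour
but `i₀` is zero or two. -/
theorem even_card_facets_of_image_ne_univ [Fintype ι] [DecidableEq ι] [DecidableEq V] (c : V → ι) (i₀ : ι) (P : Finset V)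
    (hP : P.card = Fintype.card ι) (hc : P.image c ≠ Finset.univ) (D : Finset (Finset V))
    (hD : ∀ τ ⊆ P, τ ∈ D ↔ τ.card + 1 = Fintype.card ι ∧ τ.image c = Finset.univ.erase i₀) :
    Even (D.filter (· ⊆ P)).card := by
  have key : ∀ τ, τ ∈ D.filter (· ⊆ P) ↔ ∃ x ∈ P, τ = P.erase x ∧
      (P.erase x).image c = Finset.univ.erase i₀ := by
    intro τ
    rw [Finset.mem_filter]
    constructor
    · rintro ⟨h1, h2⟩
      obtain ⟨h3, h4⟩ := (hD τ h2).1 h1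
      obtain ⟨x, hx, rfl⟩ : ∃ x ∉ τ, insert x τ = P := by
        have : τ ⋖ P := Finset.covBy_iff_card_sdiff_eq_one.2
          ⟨h2, by rw [Finset.card_sdiff_of_subset h2]; omega⟩
        exact Finset.covBy_iff_exists_insert.1 this
      exact ⟨x, Finset.mem_insert_self _ _, (Finset.erase_insert hx).symm,
        by rwa [Finset.erase_insert hx]⟩
    · rintro ⟨x, hx, rfl, h⟩
      refine ⟨(hD _ (Finset.erase_subset _ _)).2 ⟨?_, h⟩, Finset.erase_subset _ _⟩
      rw [Finset.card_erase_add_one hx, hP]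
  by_cases hne : (D.filter (· ⊆ P)) = ∅
  · simp [hne]
  obtain ⟨τ, hτ⟩ := Finset.nonempty_iff_ne_empty.2 hne
  obtain ⟨x, hx, rfl, him⟩ := (key τ).1 hτ
  have hinj : Set.InjOn c (P.erase x) := by
    apply Finset.card_image_iff.1
    rw [him, Finset.card_erase_of_mem (Finset.mem_univ _), Finset.card_erase_of_mem hx, hP,
      Finset.card_univ]
  have hPi : P.image c = insert (c x) (Finset.univ.erase i₀) := by
    rw [← him, ← Finset.image_insert, Finset.insert_erase hx]
  have hcx : c x ≠ i₀ := by
    intro h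
    exact hc (by rw [hPi, h, Finset.insert_erase (Finset.mem_univ _)])
  obtain ⟨x', hx', hcx'⟩ : ∃ x' ∈ P.erase x, c x' = c x := by
    apply Finset.mem_image.1
    rw [him]
    simp [hcx]
  obtain ⟨hne', hx'P⟩ := Finset.mem_erase.1 hx'
  have hcol : ∀ z ∈ P, c z ≠ i₀ := by
    intro z hz
    have : c z ∈ P.image c := Finset.mem_image_of_mem c hz
    rw [hPi] at this
    rcases Finset.mem_insert.1 this with h | h
    · rwa [h]
    · exact (Finset.mem_erase.1 h).1
  have : D.filter (· ⊆ P) = {P.erase x, P.erase x'} := by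
    ext τ
    rw [key]
    simp only [Finset.mem_insert, Finset.mem_singleton]
    constructor
    · rintro ⟨z, hz, rfl, h⟩
      by_contra! hcon
      have hzx : z ≠ x := fun h => hcon.1 (by rw [h])
      have hzx' : z ≠ x' := fun h => hcon.2 (by rw [h])
      have : c z ∈ (P.erase z).image c := by
        rw [h]
        simp [hcol z hz]
      obtain ⟨u, hu, huz⟩ := Finset.mem_image.1 this
      obtain ⟨hu1, hu2⟩ := Finset.mem_erase.1 hu
      by_cases hux : u = x
      · subst hux
        exact hzx' (hinj (by simp [hz, hzx]) (by simpa only [Finset.mem_coe] using hx') (by rw [← huz, hcx']))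
      · exact hu1 (hinj (by simp [hu2, hux]) (by simp [hz, hzx]) huz)
    · rintro (rfl | rfl)
      · exact ⟨x, hx, rfl, him⟩
      · refine ⟨x', hx'P, rfl, ?_⟩
        rw [← him]
        have h1 : P.erase x = insert x' ((P.erase x).erase x') := (Finset.insert_erase hx').symm
        have h2 : P.erase x' = insert x ((P.erase x).erase x') := by
          rw [Finset.erase_right_comm, Finset.insert_erase]
          simp [hx, hne'.symm]
        rw [h1, h2, Finset.image_insert, Finset.image_insert, hcx']
  rw [this, Finset.card_pair]
  · exact even_two
  · intro h
    have : x' ∈ P.erase x' := h ▸ hx'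
    simp at this

variable [LinearOrder α] {r : ι → V → α}

/-- `y` extends the facet `τ` with minima `m` in direction `q`. -/
def IsExtension (r : ι → V → α) (m : ι → V) (q : ι) (y : V) : Prop :=
  (∀ i ≠ q, r i (m i) < r i y) ∧ ∀ z, (∀ i ≠ q, r i (m i) < r i z) → r q z ≤ r q y

theorem IsExtension.unique (hr : ∀ i, Function.Injective (r i)) {m : ι → V} {q : ι} {y z : V}
    (hy : IsExtension r m q y) (hz : IsExtension r m q z) : y = z :=
  hr q (le_antisymm (hz.2 y hy.1) (hy.2 z hz.1))

theorem exists_isExtension [Fintype V] {m : ι → V} {q : ι} {z : V}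
    (hz : ∀ i ≠ q, r i (m i) < r i z) : ∃ y, IsExtension r m q y := by
  classical
  obtain ⟨y, hy, hmax⟩ := Finset.exists_max_image
    (Finset.univ.filter fun z => ∀ i ≠ q, r i (m i) < r i z) (r q) ⟨z, by simpa using hz⟩
  exact ⟨y, by simpa using hy, fun z hz => hmax z (by simpa using hz)⟩

/-- The facet data: a dominant set of one element less than the number of orders has exactly one
repeated minimum, and its one-point dominant extensions are those in the two repeated
directions. -/
theorem exists_directions_of_isDominant [Fintype ι] [DecidableEq ι] [DecidableEq V]
    [Nontrivial ι] (hr : ∀ i, Function.Injective (r i))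
    {τ : Finset V} (hτ : IsDominant r τ) (hcard : τ.card + 1 = Fintype.card ι) :
    ∃ (m : ι → V) (a b : ι), (∀ i, m i ∈ τ) ∧ (∀ i, ∀ x ∈ τ, r i (m i) ≤ r i x) ∧
      a ≠ b ∧ m a = m b ∧ (∀ i j, m i = m j → i = j ∨ (i = a ∧ j = b) ∨ (i = b ∧ j = a)) ∧
      (∀ y, (y ∉ τ ∧ IsDominant r (insert y τ)) ↔ IsExtension r m a y ∨ IsExtension r m b y) ∧
      ∀ y, IsExtension r m a y → ¬ IsExtension r m b y := by
  have hne : τ.Nonempty := by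
    rw [← Finset.card_pos]
    have := Fintype.one_lt_card (α := ι)
    omega
  choose m hm hmin using fun i => Finset.exists_min_image τ (r i) hne
  have hsurj : ∀ x ∈ τ, ∃ i, m i = x := by
    intro x hx
    obtain ⟨i, hi⟩ := hτ x
    exact ⟨i, hr i (le_antisymm (hmin i x hx) (hi _ (hm i)))⟩
  obtain ⟨a, -, b, -, hab, hmab⟩ := Finset.exists_ne_map_eq_of_card_lt_of_maps_to
    (s := Finset.univ) (t := τ) (f := m) (by rw [Finset.card_univ]; omega) (fun i _ => hm i)
  have hinj : ∀ a b, a ≠ b → m a = m b → ∀ i j, i ≠ a → j ≠ a → m i = m j → i = j := by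
    intro a b hab hmab i j hi hj hij
    have him : (Finset.univ.erase a).image m = τ := by
      ext x
      constructor
      · intro h
        obtain ⟨i, -, rfl⟩ := Finset.mem_image.1 h
        exact hm i
      · intro hx
        obtain ⟨i, rfl⟩ := hsurj x hx
        by_cases hia : i = a
        · exact Finset.mem_image.2 ⟨b, by simp [hab.symm], by rw [hia, hmab]⟩
        · exact Finset.mem_image.2 ⟨i, by simp [hia], rfl⟩
    have : Set.InjOn m (Finset.univ.erase a : Finset ι) := by
      apply Finset.card_image_iff.1
      rw [him, Finset.card_erase_of_mem (Finset.mem_univ _), Finset.card_univ]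
      omega
    exact this (by simp [hi]) (by simp [hj]) hij
  have hpair : ∀ i j, m i = m j → i = j ∨ (i = a ∧ j = b) ∨ (i = b ∧ j = a) := by
    intro i j hij
    by_contra! hcon
    obtain ⟨h1, h2, h3⟩ := hcon
    have ha := hinj a b hab hmab i j
    have hb := hinj b a hab.symm hmab.symm i j
    have hbi : i = b → i ≠ a := fun h => h ▸ hab.symm
    have hbj : j = b → j ≠ a := fun h => h ▸ hab.symm
    tauto
  have hext : ∀ q q', q ≠ q' → m q = m q' → ∀ y, IsExtension r m q y →
      y ∉ τ ∧ IsDominant r (insert y τ) := by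
    intro q q' hq hm' y hy
    have hyτ : y ∉ τ := by
      intro hyτ
      obtain ⟨i, rfl⟩ := hsurj y hyτ
      by_cases hi : i = q
      · subst hi
        have := hy.1 q' hq.symm
        rw [hm'] at this
        exact lt_irrefl _ this
      · exact lt_irrefl _ (hy.1 i hi)
    have hylt : r q y ≤ r q (m q) := by
      obtain ⟨i, hi⟩ := hτ y
      by_cases hiq : i = q
      · subst hiq
        exact hi _ (hm _)
      · exact absurd (hi _ (hm i)) (not_le.2 (hy.1 i hiq))
    refine ⟨hyτ, fun z => ?_⟩
    by_contra! hcon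
    have hz : ∀ i ≠ q, r i (m i) < r i z := by
      intro i hi
      obtain ⟨x, hx, hlt⟩ := hcon i
      rcases Finset.mem_insert.1 hx with rfl | hx
      · exact (hy.1 i hi).trans hlt
      · exact (hmin i x hx).trans_lt hlt
    obtain ⟨x, hx, hlt⟩ := hcon q
    have hzy := hy.2 z hz
    rcases Finset.mem_insert.1 hx with rfl | hx
    · exact absurd hzy (not_le.2 hlt)
    · exact absurd (hzy.trans (hylt.trans (hmin q x hx))) (not_le.2 hlt)
  refine ⟨m, a, b, hm, hmin, hab, hmab, hpair, fun y => ⟨?_, ?_⟩, ?_⟩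
  · rintro ⟨hy, hdom⟩
    -- every element of `insert y τ` is the minimum in some direction
    obtain ⟨q, hq⟩ := hdom y
    have hqlt : ∀ x ∈ τ, r q y < r q x := fun x hx =>
      lt_of_le_of_ne (hq x (Finset.mem_insert_of_mem hx)) fun h => hy (hr q h ▸ hx)
    have hothers : ∀ x ∈ τ, ∃ i ≠ q, m i = x ∧ r i x < r i y := by
      intro x hx
      obtain ⟨i, hi⟩ := hdom x
      have hix : r i x < r i y := lt_of_le_of_ne (hi y (Finset.mem_insert_self _ _))
        fun h => hy (hr i h ▸ hx)
      refine ⟨i, ?_, hr i (le_antisymm (hmin i x hx)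
        (hi _ (Finset.mem_insert_of_mem (hm i)))), hix⟩
      rintro rfl
      exact lt_asymm hix (hqlt x hx)
    have hqab : q = a ∨ q = b := by
      obtain ⟨i, hi, hmi, -⟩ := hothers (m q) (hm q)
      rcases hpair i q hmi with h | h | h
      · exact absurd h hi
      · exact Or.inr h.2
      · exact Or.inl h.2
    have hlow : ∀ i ≠ q, r i (m i) < r i y := by
      intro i hi
      obtain ⟨j, hj, hmj, hlt⟩ := hothers (m i) (hm i)
      have : j = i := by
        rcases hqab with rfl | rfl
        · exact hinj _ b hab hmab j i hj hi hmj
        · exact hinj _ a hab.symm hmab.symm j i hj hi hmj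
      rwa [this] at hlt
    have hE : IsExtension r m q y := by
      refine ⟨hlow, fun z hz => ?_⟩
      obtain ⟨i, hi⟩ := hdom z
      by_cases hiq : i = q
      · subst hiq
        exact hi y (Finset.mem_insert_self _ _)
      · exact absurd (hi _ (Finset.mem_insert_of_mem (hm i))) (not_le.2 (hz i hiq))
    rcases hqab with rfl | rfl
    · exact Or.inl hE
    · exact Or.inr hE
  · rintro (h | h)
    · exact hext a b hab hmab y h
    · exact hext b a hab.symm hmab.symm y h
  · intro y ha hb
    obtain ⟨i, hi⟩ := hτ y
    by_cases hia : i = a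
    · exact absurd (hi _ (hm i)) (not_le.2 (hb.1 i (hia ▸ hab)))
    · exact absurd (hi _ (hm i)) (not_le.2 (ha.1 i hia))


theorem card_rooms_over_facet [Fintype ι] [DecidableEq ι] [Nontrivial ι] [Fintype V]
    [DecidableEq V] (hr : ∀ i, Function.Injective (r i)) (s : ι → V) (c : V → ι)
    (hcs : ∀ i, c (s i) = i) (hlow : ∀ i v, v ≠ s i → r i (s i) < r i v)
    (hhigh : ∀ i j, i ≠ j → ∀ v ∉ Set.range s, r i v < r i (s j)) (i₀ : ι)
    (R : Finset (Finset V)) (hR : ∀ P, P ∈ R ↔ P.card = Fintype.card ι ∧ IsDominant r P)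
    {τ : Finset V} (hτ : IsDominant r τ) (hcard : τ.card + 1 = Fintype.card ι)
    (hc : τ.image c = Finset.univ.erase i₀) :
    (R.filter (τ ⊆ ·)).card = if τ = (Finset.univ.erase i₀).image s then 1 else 2 := by
  have hs : Function.Injective s := Function.LeftInverse.injective hcs
  obtain ⟨m, a, b, hm, hmin, hab, hmab, hpair, hrooms, hexcl⟩ :=
    exists_directions_of_isDominant hr hτ hcard
  have key : ∀ P, P ∈ R.filter (τ ⊆ ·) ↔
      ∃ y, y ∉ τ ∧ (IsExtension r m a y ∨ IsExtension r m b y) ∧ P = insert y τ := by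
    intro P
    rw [Finset.mem_filter, hR]
    constructor
    · rintro ⟨⟨h1, h2⟩, h3⟩
      have : τ ⋖ P := Finset.covBy_iff_card_sdiff_eq_one.2
          ⟨h3, by rw [Finset.card_sdiff_of_subset h3]; omega⟩
      obtain ⟨y, hy, rfl⟩ := Finset.covBy_iff_exists_insert.1 this
      exact ⟨y, hy, (hrooms y).1 ⟨hy, h2⟩, rfl⟩
    · rintro ⟨y, hy, h, rfl⟩
      exact ⟨⟨by rw [Finset.card_insert_of_notMem hy, hcard], ((hrooms y).2 h).2⟩,
        Finset.subset_insert _ _⟩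
  split_ifs with hspecial
  · have hmem : ∀ x, x ∈ τ ↔ ∃ j, j ≠ i₀ ∧ s j = x := by
      intro x
      simp [hspecial]
    have hms : ∀ i, i ≠ i₀ → m i = s i := by
      intro i hi
      by_contra hne
      exact absurd (hmin i (s i) ((hmem _).2 ⟨i, hi, rfl⟩)) (not_le.2 (hlow i _ hne))
    obtain ⟨q, hq, hmq, hroomsq⟩ : ∃ q, q ≠ i₀ ∧ m i₀ = m q ∧
        ∀ P, P ∈ R.filter (τ ⊆ ·) ↔
          ∃ y, y ∉ τ ∧ (IsExtension r m i₀ y ∨ IsExtension r m q y) ∧ P = insert y τ := by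
      by_cases ha : a = i₀
      · exact ⟨b, ha ▸ hab.symm, ha ▸ hmab, ha ▸ key⟩
      · by_cases hb : b = i₀
        · refine ⟨a, ha, hb ▸ hmab.symm, fun P => ?_⟩
          rw [key, hb]
          simp only [or_comm]
        · exact absurd (hs (by rw [← hms a ha, ← hms b hb, hmab])) hab
    have hno : ∀ y, ¬ IsExtension r m q y := by
      intro z hz
      have hz0 := hz.1 i₀ hq.symm
      rw [hmq, hms q hq] at hz0
      by_cases hzs : z ∈ Set.range s
      · obtain ⟨j, rfl⟩ := hzs
        by_cases hj : j = i₀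
        · subst hj
          exact lt_asymm hz0 (hlow j _ (hs.ne hq))
        · by_cases hjq : j = q
          · subst hjq
            exact lt_irrefl _ hz0
          · have := hz.1 j hjq
            rw [hms j hj] at this
            exact lt_irrefl _ this
      · exact lt_asymm hz0 (hhigh i₀ q hq.symm z hzs)
    obtain ⟨y, hy⟩ : ∃ y, IsExtension r m i₀ y := exists_isExtension (z := s i₀) fun i hi => by
      rw [hms i hi]
      exact hlow i _ (hs.ne hi.symm)
    have hyτ : y ∉ τ := by
      rw [hmem]
      rintro ⟨j, hj, rfl⟩
      have := hy.1 j hj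
      rw [hms j hj] at this
      exact lt_irrefl _ this
    rw [Finset.card_eq_one]
    refine ⟨insert y τ, ?_⟩
    ext P
    rw [hroomsq, Finset.mem_singleton]
    constructor
    · rintro ⟨z, -, hz | hz, rfl⟩
      · rw [hz.unique hr hy]
      · exact absurd hz (hno z)
    · rintro rfl
      exact ⟨y, hyτ, Or.inl hy, rfl⟩
  · have hms : ∀ i j, i ≠ j → m i ≠ s j := by
      intro i j hij hmi
      -- then every element of `τ` is one of the `s l`, `l ≠ i`
      have hsub : τ ⊆ (Finset.univ.erase i).image s := by
        intro x hx
        have hx' := hmin i x hx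
        rw [hmi] at hx'
        by_cases hxs : x ∈ Set.range s
        · obtain ⟨l, rfl⟩ := hxs
          refine Finset.mem_image_of_mem s (Finset.mem_erase.2 ⟨?_, Finset.mem_univ _⟩)
          rintro rfl
          exact absurd hx' (not_le.2 (hlow l _ (hs.ne hij.symm)))
        · exact absurd hx' (not_le.2 (hhigh i j hij x hxs))
      have heq := Finset.eq_of_subset_of_card_le hsub (by
        rw [Finset.card_image_of_injective _ hs, Finset.card_erase_of_mem (Finset.mem_univ _),
          Finset.card_univ]
        omega)
      have hci : τ.image c = Finset.univ.erase i := by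
        rw [heq, Finset.image_image]
        simp [Function.comp_def, hcs]
      have : i = i₀ := by
        by_contra hne
        have : i ∈ τ.image c := by rw [hc]; simp [hne]
        rw [hci] at this
        simp at this
      exact hspecial (this ▸ heq)
    have hlt : ∀ q, ∀ i ≠ q, r i (m i) < r i (s q) := by
      intro q i hi
      by_cases hmi : m i ∈ Set.range s
      · obtain ⟨j, hj⟩ := hmi
        have : j = i := by
          by_contra hne
          exact hms i j (Ne.symm hne) hj.symm
        rw [← hj, this]
        exact hlow i _ (hs.ne hi.symm)
      · exact hhigh i q hi _ hmi
    obtain ⟨y, hy⟩ := exists_isExtension (hlt a)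
    obtain ⟨z, hz⟩ := exists_isExtension (hlt b)
    have hyτ := ((hrooms y).2 (Or.inl hy)).1
    have hzτ := ((hrooms z).2 (Or.inr hz)).1
    rw [Finset.card_eq_two]
    refine ⟨insert y τ, insert z τ, ?_, ?_⟩
    · intro h
      have : y ∈ insert z τ := h ▸ Finset.mem_insert_self _ _
      rcases Finset.mem_insert.1 this with rfl | h
      · exact hexcl y hy hz
      · exact hyτ h
    · ext P
      rw [key]
      simp only [Finset.mem_insert, Finset.mem_singleton]
      constructor
      · rintro ⟨w, -, hw | hw, rfl⟩
        · exact Or.inl (by rw [hw.unique hr hy])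
        · exact Or.inr (by rw [hw.unique hr hz])
      · rintro (rfl | rfl)
        · exact ⟨y, hyτ, Or.inl hy, rfl⟩
        · exact ⟨z, hzτ, Or.inr hz, rfl⟩

/-- **Scarf's combinatorial theorem.** The elements `s i` play the role of slack vectors. -/
theorem exists_isDominant_image_eq_univ [Fintype ι] [DecidableEq ι] [Nontrivial ι] [Fintype V]
    [DecidableEq V] (hr : ∀ i, Function.Injective (r i)) (s : ι → V) (c : V → ι)
    (hcs : ∀ i, c (s i) = i) (hlow : ∀ i v, v ≠ s i → r i (s i) < r i v)
    (hhigh : ∀ i j, i ≠ j → ∀ v ∉ Set.range s, r i v < r i (s j)) :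
    ∃ P : Finset V, P.card = Fintype.card ι ∧ IsDominant r P ∧ P.image c = Finset.univ := by
  classical
  by_contra! hcon
  have hs : Function.Injective s := Function.LeftInverse.injective hcs
  obtain ⟨i₀⟩ : Nonempty ι := inferInstance
  set R : Finset (Finset V) :=
    Finset.univ.filter fun P => P.card = Fintype.card ι ∧ IsDominant r P with hRdef
  set D : Finset (Finset V) :=
    Finset.univ.filter fun τ => IsDominant r τ ∧ τ.card + 1 = Fintype.card ι ∧
      τ.image c = Finset.univ.erase i₀ with hDdef
  have hR : ∀ P, P ∈ R ↔ P.card = Fintype.card ι ∧ IsDominant r P := by simp [hRdef]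
  have hD : ∀ τ, τ ∈ D ↔ IsDominant r τ ∧ τ.card + 1 = Fintype.card ι ∧
      τ.image c = Finset.univ.erase i₀ := by simp [hDdef]
  have hcount := Finset.sum_card_bipartiteAbove_eq_sum_card_bipartiteBelow
    (s := D) (t := R) (fun τ P => τ ⊆ P)
  have hspecial : (Finset.univ.erase i₀).image s ∈ D := by
    rw [hD]
    refine ⟨fun y => ?_, ?_, ?_⟩
    · by_cases hy : y ∈ Set.range s
      · obtain ⟨j, rfl⟩ := hy
        refine ⟨j, fun x _ => ?_⟩
        by_cases hx : x = s j
        · rw [hx]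
        · exact (hlow j x hx).le
      · refine ⟨i₀, fun x hx => ?_⟩
        obtain ⟨j, hj, rfl⟩ := Finset.mem_image.1 hx
        exact (hhigh i₀ j (Finset.mem_erase.1 hj).1.symm y hy).le
    · rw [Finset.card_image_of_injective _ hs, Finset.card_erase_add_one (Finset.mem_univ _),
        Finset.card_univ]
    · rw [Finset.image_image]
      simp [Function.comp_def, hcs]
  have heven : Even (∑ P ∈ R, (Finset.bipartiteBelow (fun τ P => τ ⊆ P) D P).card) := by
    refine Finset.even_sum _ fun P hP => ?_
    obtain ⟨h1, h2⟩ := (hR P).1 hP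
    refine even_card_facets_of_image_ne_univ c i₀ P h1 (hcon P h1 h2) D fun τ hτ => ?_
    rw [hD]
    refine and_iff_right fun y => ?_
    obtain ⟨i, hi⟩ := h2 y
    exact ⟨i, fun x hx => hi x (hτ hx)⟩
  rw [← hcount] at heven
  have hdoors : ∀ τ ∈ D, (Finset.bipartiteAbove (fun τ P => τ ⊆ P) R τ).card =
      if τ = (Finset.univ.erase i₀).image s then 1 else 2 := by
    intro τ hτ
    obtain ⟨h1, h2, h3⟩ := (hD τ).1 hτ
    convert card_rooms_over_facet hr s c hcs hlow hhigh i₀ R hR h1 h2 h3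
    ext P
    simp [Finset.bipartiteAbove]
  rw [Finset.sum_congr rfl hdoors, ← Finset.add_sum_erase _ _ hspecial, if_pos rfl] at heven
  have hrest : Even (∑ τ ∈ D.erase ((Finset.univ.erase i₀).image s),
      if τ = (Finset.univ.erase i₀).image s then 1 else 2) := by
    refine Finset.even_sum _ fun τ hτ => ?_
    rw [if_neg (Finset.mem_erase.1 hτ).1]
    exact even_two
  rw [Nat.even_add] at heven
  exact absurd (heven.2 hrest) (by decide)

end Scarf

/-- A colouring of the integer points of the dilated simplex has, near some point, all colours
`i` except possibly those for which the `i`-th coordinate is small. -/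
theorem exists_nearly_multicoloured_point {ι : Type*} [Fintype ι] [DecidableEq ι] [Nontrivial ι]
    (m : ℕ) (c : (ι → ℕ) → ι) :
    ∃ x : ι → ℕ, ∑ i, x i = m ∧ ∀ i, x i ≤ Fintype.card ι ∨
      ∃ x' : ι → ℕ, ∑ i, x' i = m ∧ c x' = i ∧
        ∀ l, x' l ≤ x l + Fintype.card ι ∧ x l ≤ x' l + Fintype.card ι := by
  classical
  let T : Finset (ι → ℕ) := Finset.piAntidiag Finset.univ m
  have hT : ∀ x, x ∈ T ↔ ∑ i, x i = m := by simp [T]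
  let h : ι → T ⊕ ι → ℕ := fun i => Sum.elim (fun x => x.1 i + 1)
    fun j => if j = i then 0 else m + 2
  let r : ι → T ⊕ ι → ℕ ×ₗ Fin (Fintype.card (T ⊕ ι)) :=
    fun i v => toLex (h i v, Fintype.equivFin _ v)
  have hr_lt : ∀ i v w, h i v < h i w → r i v < r i w := fun i v w hvw =>
    Prod.Lex.toLex_lt_toLex.2 (Or.inl hvw)
  have hh_le : ∀ i v w, r i v ≤ r i w → h i v ≤ h i w := fun i v w hvw =>
    not_lt.1 fun hlt => absurd hvw (not_le.2 (hr_lt i w v hlt))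
  have hle : ∀ x ∈ T, ∀ i, x i ≤ m := fun x hx i => by
    rw [← (hT x).1 hx]
    exact Finset.single_le_sum (fun _ _ => Nat.zero_le _) (Finset.mem_univ i)
  obtain ⟨P, -, hdom, hcol⟩ := exists_isDominant_image_eq_univ (r := r)
    (fun i v w hvw => by simpa [r] using congrArg (fun p => (ofLex p).2) hvw)
    Sum.inr (Sum.elim (fun x => c x.1) id) (fun i => rfl)
    (fun i v hv => hr_lt _ _ _ (by
      rcases v with x | j
      · simp [h]
      · have : j ≠ i := fun hji => hv (by rw [hji])
        simp [h, this]))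
    (fun i j hij v hv => hr_lt _ _ _ (by
      rcases v with x | l
      · have := hle x.1 x.2 i
        simp only [h, Sum.elim_inl, Sum.elim_inr, if_neg hij.symm]
        omega
      · exact absurd ⟨l, rfl⟩ hv))
  -- the directions in which the slack element is absent
  let C : Finset ι := Finset.univ.filter fun i => Sum.inr i ∉ P
  have hC : ∀ i, i ∈ C ↔ Sum.inr i ∉ P := by simp [C]
  have hreal : ∀ i ∈ C, ∃ x : T, Sum.inl x ∈ P ∧ c x.1 = i := by
    intro i hi
    have : i ∈ P.image (Sum.elim (fun x : T => c x.1) id) := hcol ▸ Finset.mem_univ i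
    obtain ⟨v, hv, hvi⟩ := Finset.mem_image.1 this
    rcases v with x | j
    · exact ⟨x, hv, hvi⟩
    · have : j = i := hvi
      exact absurd (this ▸ hv) ((hC i).1 hi)
  have hdomC : ∀ y ∈ T, ∃ i ∈ C, ∀ x : T, Sum.inl x ∈ P → y i ≤ x.1 i := by
    intro y hy
    obtain ⟨i, hi⟩ := hdom (Sum.inl ⟨y, hy⟩)
    refine ⟨i, (hC i).2 fun hiP => ?_, fun x hx => ?_⟩
    · have := hh_le _ _ _ (hi _ hiP)
      simp [h] at this
    · have := hh_le _ _ _ (hi _ hx)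
      simpa [h] using this
  have hCne : ∃ i, i ∈ C := by
    obtain ⟨i, hi, -⟩ := hdomC (Pi.single (Classical.arbitrary ι) m) (by simp [hT])
    exact ⟨i, hi⟩
  obtain ⟨i₁, hi₁⟩ := hCne
  obtain ⟨x₀, hx₀, -⟩ := hreal i₁ hi₁
  let Q : Finset T := Finset.univ.filter fun x => Sum.inl x ∈ P
  have hQ : ∀ x, x ∈ Q ↔ Sum.inl x ∈ P := by simp [Q]
  choose z hz hzmin using fun i =>
    Finset.exists_min_image Q (fun x => x.1 i) ⟨x₀, (hQ _).2 hx₀⟩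
  have hsum : m < ∑ i ∈ C, ((z i).1 i + 1) := by
    by_contra! hcon
    let y : ι → ℕ := fun i => (if i ∈ C then (z i).1 i + 1 else 0) +
      (if i = i₁ then m - ∑ i ∈ C, ((z i).1 i + 1) else 0)
    obtain ⟨i, hi, hiy⟩ := hdomC y ((hT _).2 (by
      simp only [y, Finset.sum_add_distrib, Finset.sum_ite_mem, Finset.univ_inter,
        Finset.sum_ite_eq', Finset.mem_univ, if_true]
      rw [Finset.sum_add_distrib] at hcon
      omega))
    have := hiy (z i) ((hQ _).1 (hz i))
    simp only [y, if_pos hi] at this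
    omega
  have hbound : ∀ x ∈ Q, (∀ i ∈ C, x.1 i ≤ (z i).1 i + Fintype.card ι) ∧
      ∀ i ∉ C, x.1 i ≤ Fintype.card ι := by
    intro x hx
    have hxm : ∑ i ∈ C, x.1 i + ∑ i ∈ Cᶜ, x.1 i = m := by
      rw [Finset.sum_add_sum_compl, (hT _).1 x.2]
    have hcardC : C.card ≤ Fintype.card ι := Finset.card_le_univ C
    rw [Finset.sum_add_distrib, Finset.sum_const, smul_eq_mul, mul_one] at hsum
    constructor
    · intro i hi
      rw [← Finset.add_sum_erase _ _ hi] at hxm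
      rw [← Finset.add_sum_erase _ _ hi] at hsum
      have : ∑ j ∈ C.erase i, (z j).1 j ≤ ∑ j ∈ C.erase i, x.1 j :=
        Finset.sum_le_sum fun j _ => hzmin j x hx
      omega
    · intro i hi
      have h1 : ∑ j ∈ C, (z j).1 j ≤ ∑ j ∈ C, x.1 j :=
        Finset.sum_le_sum fun j _ => hzmin j x hx
      have h2 : x.1 i ≤ ∑ j ∈ Cᶜ, x.1 j :=
        Finset.single_le_sum (f := x.1) (fun _ _ => Nat.zero_le _) (Finset.mem_compl.2 hi)
      omega
  refine ⟨x₀.1, (hT _).1 x₀.2, fun i => ?_⟩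
  have hx₀Q := (hQ _).2 hx₀
  by_cases hi : i ∈ C
  · obtain ⟨x, hx, hxi⟩ := hreal i hi
    have hxQ := (hQ _).2 hx
    refine Or.inr ⟨x.1, (hT _).1 x.2, hxi, fun l => ?_⟩
    by_cases hl : l ∈ C
    · have h1 := (hbound x hxQ).1 l hl
      have h2 := (hbound x₀ hx₀Q).1 l hl
      have h3 := hzmin l x hxQ
      have h4 := hzmin l x₀ hx₀Q
      omega
    · have h1 := (hbound x hxQ).2 l hl
      have h2 := (hbound x₀ hx₀Q).2 l hl
      omega
  · exact Or.inl ((hbound x₀ hx₀Q).2 i hi)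

theorem IsCompact.exists_forall_pos_mem {X : Type*} [TopologicalSpace X] [T2Space X] {S : Set X}
    (hS : IsCompact S) (K : ℝ → Set X) (hclosed : ∀ δ, IsClosed (K δ)) (hmono : Monotone K)
    (hne : ∀ δ > 0, ∃ x ∈ S, x ∈ K δ) : ∃ x ∈ S, ∀ δ > 0, x ∈ K δ := by
  have : Nonempty {δ : ℝ // 0 < δ} := ⟨⟨1, one_pos⟩⟩
  obtain ⟨x, hx⟩ := IsCompact.nonempty_iInter_of_directed_nonempty_isCompact_isClosed
    (fun δ : {δ : ℝ // 0 < δ} => S ∩ K δ)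
    (fun a b => ⟨⟨min a b, lt_min a.2 b.2⟩,
      Set.inter_subset_inter_right S (hmono (min_le_left _ _)),
      Set.inter_subset_inter_right S (hmono (min_le_right _ _))⟩)
    (fun δ => hne δ δ.2) (fun δ => hS.inter_right (hclosed δ))
    (fun δ => hS.isClosed.inter (hclosed δ))
  rw [Set.mem_iInter] at hx
  exact ⟨x, (hx ⟨1, one_pos⟩).1, fun δ hδ => (hx ⟨δ, hδ⟩).2⟩

/-- Approximate version of the dual KKM theorem. -/
theorem exists_mem_cthickening_of_cover {ι : Type*} [Fintype ι] [Nontrivial ι]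
    (D : ι → Set (ι → ℝ)) (hcover : ∀ x ∈ stdSimplex ℝ ι, ∃ i, x ∈ D i) {δ : ℝ} (hδ : 0 < δ) :
    ∃ x ∈ stdSimplex ℝ ι, ∀ i, x ∈ Metric.cthickening δ (D i) ∪ {x | x i ≤ δ} := by
  classical
  obtain ⟨m, hm⟩ := exists_nat_gt ((Fintype.card ι : ℝ) / δ)
  have hm0 : (0 : ℝ) < m := lt_of_le_of_lt (by positivity) hm
  have hcard : (Fintype.card ι : ℝ) / m ≤ δ := by
    rw [div_lt_iff₀ hδ] at hm
    rw [div_le_iff₀ hm0]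
    linarith
  let scale : (ι → ℕ) → ι → ℝ := fun x i => (x i : ℝ) / m
  have hscale : ∀ x : ι → ℕ, ∑ i, x i = m → scale x ∈ stdSimplex ℝ ι := by
    intro x hx
    refine ⟨fun i => by positivity, ?_⟩
    rw [← Finset.sum_div, ← Nat.cast_sum, hx, div_self hm0.ne']
  have hc : ∀ x : ι → ℕ, ∃ i, ∑ i, x i = m → scale x ∈ D i := by
    intro x
    by_cases hx : ∑ i, x i = m
    · obtain ⟨i, hi⟩ := hcover _ (hscale x hx)
      exact ⟨i, fun _ => hi⟩
    · exact ⟨Classical.arbitrary ι, fun h => absurd h hx⟩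
  choose c hc using hc
  obtain ⟨x, hx, hcol⟩ := exists_nearly_multicoloured_point m c
  refine ⟨scale x, hscale x hx, fun i => ?_⟩
  rcases hcol i with hi | ⟨x', hx', rfl, hdist⟩
  · right
    refine le_trans ?_ hcard
    change (x i : ℝ) / m ≤ _
    gcongr
  · left
    refine Metric.mem_cthickening_of_dist_le _ _ _ _ (hc x' hx') ?_
    refine ((dist_pi_le_iff (by positivity)).2 fun l => ?_).trans hcard
    obtain ⟨h1, h2⟩ := hdist l
    have h1' : (x' l : ℝ) ≤ x l + Fintype.card ι := by exact_mod_cast h1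
    have h2' : (x l : ℝ) ≤ x' l + Fintype.card ι := by exact_mod_cast h2
    rw [Real.dist_eq, ← sub_div, abs_div, abs_of_pos hm0]
    gcongr
    rw [abs_le]
    constructor <;> linarith

/-- The dual form of the KKM theorem: a closed cover of the simplex whose `i`-th member contains
the facet opposite to the `i`-th vertex has a common point. -/
theorem exists_mem_of_closed_cover_of_facet_subset {ι : Type*} [Fintype ι] [Nonempty ι]
    (D : ι → Set (ι → ℝ)) (hclosed : ∀ i, IsClosed (D i))
    (hcover : ∀ x ∈ stdSimplex ℝ ι, ∃ i, x ∈ D i)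
    (hfacet : ∀ x ∈ stdSimplex ℝ ι, ∀ i, x i = 0 → x ∈ D i) :
    ∃ x ∈ stdSimplex ℝ ι, ∀ i, x ∈ D i := by
  rcases subsingleton_or_nontrivial ι with hι | hι
  · obtain ⟨i⟩ : Nonempty ι := inferInstance
    have hx : Pi.single i (1 : ℝ) ∈ stdSimplex ℝ ι := single_mem_stdSimplex ℝ i
    obtain ⟨j, hj⟩ := hcover _ hx
    exact ⟨_, hx, fun l => Subsingleton.elim j l ▸ hj⟩
  obtain ⟨x, hx, hK⟩ := (isCompact_stdSimplex ℝ ι).exists_forall_pos_mem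
    (fun δ => ⋂ i, (Metric.cthickening δ (D i) ∪ {x | x i ≤ δ}))
    (fun δ => isClosed_iInter fun i => Metric.isClosed_cthickening.union
      (isClosed_le (continuous_apply i) continuous_const))
    (fun δ δ' h => Set.iInter_mono fun i => Set.union_subset_union (Metric.cthickening_mono h _)
      fun x (hx : x i ≤ δ) => hx.trans h)
    (fun δ hδ => (exists_mem_cthickening_of_cover D hcover hδ).imp fun x h =>
      ⟨h.1, Set.mem_iInter.2 h.2⟩)
  refine ⟨x, hx, fun i => ?_⟩
  rcases (hx.1 i).eq_or_lt with h0 | hpos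
  · exact hfacet x hx i h0.symm
  rw [← (hclosed i).closure_eq, Metric.closure_eq_iInter_cthickening]
  refine Set.mem_iInter₂.2 fun δ hδ => ?_
  have hδ' : 0 < min δ (x i / 2) := lt_min hδ (half_pos hpos)
  rcases Set.mem_iInter.1 (hK _ hδ') i with h | h
  · exact Metric.cthickening_mono (min_le_left _ _) _ h
  · have : x i ≤ x i / 2 := le_trans h (min_le_right _ _)
    linarith

theorem exists_forall_one_le_of_card_le_sum {ι : Type*} [Fintype ι] [Nonempty ι]
    (F : ι → (ι → ℝ) → ℝ) (hF : ∀ i, Continuous (F i)) (hzero : ∀ x i, x i = 0 → F i x = 0)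
    (hsum : ∀ x ∈ stdSimplex ℝ ι, (Fintype.card ι : ℝ) ≤ ∑ i, F i x) :
    ∃ x ∈ stdSimplex ℝ ι, ∀ i, 1 ≤ F i x := by
  let d : ι → (ι → ℝ) → ℝ := fun i x => max 0 (1 - F i x)
  have hd0 : ∀ i x, 0 ≤ d i x := fun i x => le_max_left _ _
  have hd : ∀ i, Continuous (d i) := fun i => by fun_prop
  obtain ⟨x, hx, hxD⟩ := exists_mem_of_closed_cover_of_facet_subset
    (fun i => {x | x i * ∑ l, d l x ≤ d i x})
    (fun i => isClosed_le (by fun_prop) (hd i))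
    (by
      intro x hx
      by_contra! hcon
      have : ∑ i, d i x < ∑ i, x i * ∑ l, d l x :=
        Finset.sum_lt_sum_of_nonempty Finset.univ_nonempty fun i _ => not_le.1 (hcon i)
      rw [← Finset.sum_mul, hx.2, one_mul] at this
      exact lt_irrefl _ this)
    (fun x _ i hi => by simpa [hi] using hd0 i x)
  have heq : ∀ i, x i * ∑ l, d l x = d i x := by
    have := (Finset.sum_eq_sum_iff_of_le (s := Finset.univ)
      (f := fun i => x i * ∑ l, d l x) (g := fun i => d i x) (fun i _ => hxD i)).1
      (by rw [← Finset.sum_mul, hx.2, one_mul])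
    exact fun i => this i (Finset.mem_univ i)
  refine ⟨x, hx, fun i => ?_⟩
  by_contra! hlt
  have hdi : 0 < d i x := lt_max_of_lt_right (by linarith)
  have hD : 0 < ∑ l, d l x := hdi.trans_le
    (Finset.single_le_sum (f := fun l => d l x) (fun l _ => hd0 l x) (Finset.mem_univ i))
  have hall : ∀ l, F l x < 1 := by
    intro l
    rcases (hx.1 l).eq_or_lt with h0 | hpos
    · rw [hzero x l h0.symm]
      exact one_pos
    · have : 0 < d l x := heq l ▸ mul_pos hpos hD
      rcases lt_max_iff.1 this with h | h
      · exact absurd h (lt_irrefl _)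
      · linarith
  have : ∑ l, F l x < ∑ _l : ι, (1 : ℝ) :=
    Finset.sum_lt_sum_of_nonempty Finset.univ_nonempty fun l _ => hall l
  have h2 := hsum x hx
  simp at this
  linarith

/-- A nonnegative matrix whose row sums are at most one and whose column sums are at least one
has a positive transversal meeting every column. -/
theorem exists_injective_forall_pos_of_sum {n ι : Type*} [Fintype n] [Fintype ι]
    (M : n → ι → ℝ) (h0 : ∀ j i, 0 ≤ M j i) (hrow : ∀ j, ∑ i, M j i ≤ 1)
    (hcol : ∀ i, 1 ≤ ∑ j, M j i) : ∃ π : ι → n, Function.Injective π ∧ ∀ i, 0 < M (π i) i := by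
  classical
  obtain ⟨π, hπ, hmem⟩ := (Finset.all_card_le_biUnion_card_iff_exists_injective
    fun i => Finset.univ.filter fun j => 0 < M j i).1 (by
      intro s
      set N := s.biUnion fun i => Finset.univ.filter fun j => 0 < M j i with hN
      have h1 : ∀ j ∉ N, ∑ i ∈ s, M j i = 0 := by
        intro j hj
        refine Finset.sum_eq_zero fun i hi => le_antisymm (not_lt.1 fun hpos => hj ?_) (h0 j i)
        exact Finset.mem_biUnion.2 ⟨i, hi, by simpa using hpos⟩
      have : (s.card : ℝ) ≤ N.card := calc
        (s.card : ℝ) = ∑ i ∈ s, (1 : ℝ) := by simp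
        _ ≤ ∑ i ∈ s, ∑ j, M j i := Finset.sum_le_sum fun i _ => hcol i
        _ = ∑ j, ∑ i ∈ s, M j i := Finset.sum_comm
        _ = ∑ j ∈ N, ∑ i ∈ s, M j i :=
          (Finset.sum_subset (Finset.subset_univ N) fun j _ hj => h1 j hj).symm
        _ ≤ ∑ j ∈ N, (1 : ℝ) := Finset.sum_le_sum fun j _ =>
          (Finset.sum_le_univ_sum_of_nonneg fun i => h0 j i).trans (hrow j)
        _ = N.card := by simp
      exact_mod_cast this)
  exact ⟨π, hπ, fun i => by simpa using hmem i⟩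

/-- Every point of the simplex is close to a point whose support only contains coordinates
that were not too small. -/
theorem exists_dist_le_of_pos_imp_le {ι : Type*} [Fintype ι] [Nonempty ι] {ε η : ℝ}
    (hη : 0 < η) (hη1 : Fintype.card ι * η ≤ 1) (hηε : Fintype.card ι * η ≤ ε) {y : ι → ℝ}
    (hy : y ∈ stdSimplex ℝ ι) :
    ∃ x ∈ stdSimplex ℝ ι, dist x y ≤ ε ∧ ∀ i, 0 < x i → η ≤ y i := by
  classical
  obtain ⟨i₀, hi₀⟩ : ∃ i₀, η ≤ y i₀ := by
    by_contra! hcon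
    have : ∑ i, y i < ∑ _i : ι, η :=
      Finset.sum_lt_sum_of_nonempty Finset.univ_nonempty fun i _ => hcon i
    rw [hy.2] at this
    simp at this
    linarith
  let z : ι → ℝ := fun i => if η ≤ y i then 0 else y i
  have hz0 : ∀ i, 0 ≤ z i := by
    intro i
    have := hy.1 i
    simp only [z]
    split_ifs <;> linarith
  have hzη : ∀ i, z i ≤ η := by
    intro i
    simp only [z]
    split_ifs <;> linarith
  have hzy : ∀ i, z i ≤ y i := by
    intro i
    have := hy.1 i
    simp only [z]
    split_ifs <;> linarith
  have hzs0 : 0 ≤ ∑ l, z l := Finset.sum_nonneg fun l _ => hz0 l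
  have hzs : ∑ l, z l ≤ ε := calc
    ∑ l, z l ≤ ∑ _l : ι, η := Finset.sum_le_sum fun l _ => hzη l
    _ ≤ ε := by simpa using hηε
  refine ⟨fun i => y i - z i + if i = i₀ then ∑ l, z l else 0, ⟨fun i => ?_, ?_⟩, ?_, ?_⟩
  · have := hzy i
    dsimp only
    split_ifs <;> linarith
  · simp [Finset.sum_add_distrib, Finset.sum_sub_distrib, hy.2]
  · refine (dist_pi_le_iff (hzs0.trans hzs)).2 fun i => ?_
    rw [Real.dist_eq, abs_le]
    have h1 := hz0 i
    have h2 : z i ≤ ∑ l, z l := Finset.single_le_sum (fun l _ => hz0 l) (Finset.mem_univ i)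
    split_ifs <;> constructor <;> linarith
  · intro i hi
    by_contra! hlt
    have hne : i ≠ i₀ := by
      rintro rfl
      exact absurd hi₀ (not_le.2 hlt)
    have : z i = y i := if_neg (not_le.2 hlt)
    simp [this, hne] at hi

theorem exists_injective_mem_cthickening (n k : ℕ) (hk : 1 ≤ k) (hkn : k ≤ n)
    (A : Fin n → Fin k → Set (Fin k → ℝ))
    (hKKM : ∀ I : Finset (Fin n), I.card = n - k + 1 →
      ∀ σ : Finset (Fin k), σ.Nonempty →
        simplexFace k σ ⊆ ⋃ i ∈ σ, ⋃ j ∈ I, A j i) {ε : ℝ} (hε : 0 < ε) :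
    ∃ π : Fin k → Fin n, Function.Injective π ∧
      ∃ y ∈ stdSimplex ℝ (Fin k), ∀ i, y ∈ Metric.cthickening (ε + ε) (A (π i) i) := by
  classical
  have : Nonempty (Fin k) := ⟨⟨0, hk⟩⟩
  have hk0 : (0 : ℝ) < k := by exact_mod_cast hk
  obtain ⟨η, hη, hη1, hηε⟩ : ∃ η : ℝ, 0 < η ∧ Fintype.card (Fin k) * η ≤ 1 ∧
      Fintype.card (Fin k) * η ≤ ε := by
    refine ⟨min 1 ε / k, by positivity, ?_⟩
    rw [Fintype.card_fin, mul_div_cancel₀ _ hk0.ne']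
    exact ⟨min_le_left _ _, min_le_right _ _⟩
  let w : Fin n → Fin k → (Fin k → ℝ) → ℝ := fun j i y =>
    min 1 (max 0 (y i) / η) * (thickenedIndicator hε (Metric.cthickening ε (A j i)) y : ℝ)
  have hw : ∀ j i, Continuous (w j i) := by
    intro j i
    have := (thickenedIndicator hε (Metric.cthickening ε (A j i))).continuous
    simp only [w]
    fun_prop
  have hw0 : ∀ j i y, 0 ≤ w j i y := fun j i y => by positivity
  let r : Fin n → Fin k → (Fin k → ℝ) → ℝ := fun j i y => w j i y / max 1 (∑ l, w j l y)
  have hmax : ∀ j y, 0 < max 1 (∑ l, w j l y) := fun j y => lt_max_of_lt_left one_pos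
  have hr : ∀ j i, Continuous (r j i) := fun j i =>
    (hw j i).div (continuous_const.max (continuous_finsetSum _ fun l _ => hw j l))
      fun y => (hmax j y).ne'
  have hr0 : ∀ j i y, 0 ≤ r j i y := fun j i y => div_nonneg (hw0 j i y) (hmax j y).le
  have hrows : ∀ y ∈ stdSimplex ℝ (Fin k),
      k ≤ (Finset.univ.filter fun j => 1 ≤ ∑ l, w j l y).card := by
    intro y hy
    obtain ⟨x, hx, hxy, hpos⟩ := exists_dist_le_of_pos_imp_le hη hη1 hηε hy
    set J := Finset.univ.filter fun j => 1 ≤ ∑ l, w j l y with hJ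
    by_contra! hlt
    obtain ⟨I, hIJ, hI⟩ := Finset.exists_subset_card_eq (s := Jᶜ) (n := n - k + 1) (by
      rw [Finset.card_compl, Fintype.card_fin]
      omega)
    have hσ : (Finset.univ.filter fun i => 0 < x i).Nonempty := by
      by_contra hemp
      rw [Finset.not_nonempty_iff_eq_empty, Finset.filter_eq_empty_iff] at hemp
      have h1 : ∑ i, x i ≤ 0 :=
        Finset.sum_nonpos fun i hi => not_lt.1 (hemp (Finset.mem_univ i))
      rw [hx.2] at h1
      linarith
    have hmem := hKKM I hI _ hσ
      ⟨hx, fun i hi => le_antisymm (not_lt.1 (by simpa using hi)) (hx.1 i)⟩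
    simp only [Set.mem_iUnion, Finset.mem_filter, Finset.mem_univ, true_and] at hmem
    obtain ⟨i, hi, j, hjI, hxA⟩ := hmem
    have hyi := hpos i hi
    have hwij : w j i y = 1 := by
      have h1 : 1 ≤ max 0 (y i) / η := by
        rw [le_div_iff₀ hη, one_mul]
        exact hyi.trans (le_max_right _ _)
      have h2 : y ∈ Metric.cthickening ε (A j i) :=
        Metric.mem_cthickening_of_dist_le _ _ _ _ hxA (dist_comm x y ▸ hxy)
      simp only [w]
      rw [min_eq_left h1, thickenedIndicator_one hε _ h2]
      simp
    have : j ∈ J := by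
      rw [hJ, Finset.mem_filter]
      refine ⟨Finset.mem_univ _, ?_⟩
      rw [← hwij]
      exact Finset.single_le_sum (f := fun l => w j l y) (fun l _ => hw0 j l y)
        (Finset.mem_univ i)
    exact Finset.mem_compl.1 (hIJ hjI) this
  obtain ⟨y, hy, hcol⟩ := exists_forall_one_le_of_card_le_sum (fun i y => ∑ j, r j i y)
    (fun i => continuous_finsetSum _ fun j _ => hr j i)
    (fun y i hi => by simp [r, w, hi])
    (fun y hy => by
      rw [Finset.sum_comm, Fintype.card_fin]
      calc (k : ℝ) ≤ (Finset.univ.filter fun j => 1 ≤ ∑ l, w j l y).card := by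
            exact_mod_cast hrows y hy
        _ = ∑ j ∈ Finset.univ.filter fun j => 1 ≤ ∑ l, w j l y, (1 : ℝ) := by simp
        _ ≤ ∑ j ∈ Finset.univ.filter fun j => 1 ≤ ∑ l, w j l y, ∑ i, r j i y := by
            refine Finset.sum_le_sum fun j hj => ?_
            have h1 := (Finset.mem_filter.1 hj).2
            simp only [r]
            rw [← Finset.sum_div, max_eq_right h1, div_self (by linarith)]
        _ ≤ ∑ j, ∑ i, r j i y := Finset.sum_le_univ_sum_of_nonneg fun j =>
            Finset.sum_nonneg fun i _ => hr0 j i y)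
  obtain ⟨π, hπ, hpos⟩ := exists_injective_forall_pos_of_sum (fun j i => r j i y)
    (fun j i => hr0 j i y)
    (fun j => by
      simp only [r]
      rw [← Finset.sum_div, div_le_one (hmax j y)]
      exact le_max_right _ _) hcol
  refine ⟨π, hπ, y, hy, fun i => ?_⟩
  by_contra hcon
  have hnot : y ∉ Metric.thickening ε (Metric.cthickening ε (A (π i) i)) := fun h =>
    hcon (Metric.thickening_subset_cthickening _ _
      (Metric.thickening_cthickening_subset ε hε.le _ h))
  have : r (π i) i y = 0 := by
    simp only [r, w]
    rw [thickenedIndicator_zero hε _ hnot]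
    simp
  exact absurd this (hpos i).ne'

/-- **Soberón's sparse colorful KKM theorem.** Let `n ≥ k ≥ 1` and for each
`j ∈ [n]` let `(A_1^j, …, A_k^j)` be closed subsets of `Δ^{k-1}` such that for every
`I ⊆ [n]` with `|I| = n - k + 1` the family `(⋃_{j∈I} A_1^j, …, ⋃_{j∈I} A_k^j)` is a
KKM cover.  Then there is an injection `π : [k] → [n]` with `⋂_{i=1}^k A_i^{π(i)} ≠ ∅`. -/
theorem sparse_colorful_kkm (n k : ℕ) (hk : 1 ≤ k) (hkn : k ≤ n)
    (A : Fin n → Fin k → Set (Fin k → ℝ))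
    (hclosed : ∀ j i, IsClosed (A j i))
    (hsub : ∀ j i, A j i ⊆ stdSimplex ℝ (Fin k))
    (hKKM : ∀ I : Finset (Fin n), I.card = n - k + 1 →
      ∀ σ : Finset (Fin k), σ.Nonempty →
        simplexFace k σ ⊆ ⋃ i ∈ σ, ⋃ j ∈ I, A j i) :
    ∃ π : Fin k → Fin n, Function.Injective π ∧ (⋂ i, A (π i) i).Nonempty := by
  have huniform : ∃ π : Fin k → Fin n, Function.Injective π ∧ ∀ ε > 0,
      ∃ y ∈ stdSimplex ℝ (Fin k), y ∈ ⋂ i, Metric.cthickening ε (A (π i) i) := by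
    by_contra! hcon
    have hfail : ∀ π : Fin k → Fin n, ∃ ε > 0, Function.Injective π →
        ∀ y ∈ stdSimplex ℝ (Fin k), y ∉ ⋂ i, Metric.cthickening ε (A (π i) i) := by
      intro π
      by_cases hπ : Function.Injective π
      · obtain ⟨ε, hε, h⟩ := hcon π hπ
        exact ⟨ε, hε, fun _ => h⟩
      · exact ⟨1, one_pos, fun h => absurd h hπ⟩
    choose ε hε hfail using hfail
    have : Nonempty (Fin k → Fin n) := ⟨Fin.castLE hkn⟩
    obtain ⟨π₀, hπ₀⟩ := Finite.exists_min ε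
    obtain ⟨π, hπ, y, hy, hmem⟩ :=
      exists_injective_mem_cthickening n k hk hkn A hKKM (half_pos (hε π₀))
    refine hfail π hπ y hy (Set.mem_iInter.2 fun i => ?_)
    exact Metric.cthickening_mono ((add_halves (ε π₀)).trans_le (hπ₀ π)) _ (hmem i)
  obtain ⟨π, hπ, happrox⟩ := huniform
  obtain ⟨y, -, hy⟩ := (isCompact_stdSimplex ℝ (Fin k)).exists_forall_pos_mem
    (fun ε => ⋂ i, Metric.cthickening ε (A (π i) i))
    (fun ε => isClosed_iInter fun i => Metric.isClosed_cthickening)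
    (fun δ δ' h => Set.iInter_mono fun i => Metric.cthickening_mono h _) happrox
  refine ⟨π, hπ, y, Set.mem_iInter.2 fun i => ?_⟩
  rw [← (hclosed (π i) i).closure_eq, Metric.closure_eq_iInter_cthickening]
  exact Set.mem_iInter₂.2 fun ε hε => Set.mem_iInter.1 (hy ε hε) i
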